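/- arXiv:2107.03523 — 2 statements merged into one kernel-verified Lean document; each statement's English description precedes it below -/
import Mathlib

section
/- For every integer r ≥ 1 and every real x > 0, max{x, r} ≤ λ_r(x) ≤ x + r. Consequently (using λ_{r−1}(x) ≥ x), λ_r(x) ≤ λ_{r−1}(x) + r. -/
open Filter Real

/-- `truncMean ℓ x` is the mean of a Poisson(x) random variable conditioned on
being at least `ℓ`, i.e. `λ_ℓ(x) = (∑_{i≥ℓ} i·x^i/i!)/(∑_{i≥ℓ} x^i/i!)`. -/
noncomputable def truncMean (ℓ : ℕ) (x : ℝ) : ℝ :=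
  (∑' i : ℕ, if ℓ ≤ i then (i : ℝ) * x ^ i / (Nat.factorial i : ℝ) else 0) /
  (∑' i : ℕ, if ℓ ≤ i then x ^ i / (Nat.factorial i : ℝ) else 0)

theorem tsum_ite_le_eq_tsum_add (r : ℕ) {f : ℕ → ℝ} (hf : Summable f) :
    (∑' i : ℕ, if r ≤ i then f i else 0) = ∑' j : ℕ, f (j + r) := by
  have hs : Summable fun i : ℕ => if r ≤ i then f i else 0 := by
    rw [← summable_nat_add_iff r]
    simpa using (summable_nat_add_iff r).2 hf
  rw [← hs.sum_add_tsum_nat_add r, Finset.sum_eq_zero, zero_add]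
  · simp
  · intro i hi
    rw [if_neg (by simpa using hi)]

theorem succ_mul_pow_div_factorial (x : ℝ) (n : ℕ) :
    ((n + 1 : ℕ) : ℝ) * x ^ (n + 1) / (Nat.factorial (n + 1) : ℝ) =
      x * (x ^ n / (Nat.factorial n : ℝ)) := by
  rw [Nat.factorial_succ]
  push_cast
  field_simp
  ring

theorem summable_mul_pow_div_factorial (x : ℝ) :
    Summable fun i : ℕ => (i : ℝ) * x ^ i / (Nat.factorial i : ℝ) := by
  rw [← summable_nat_add_iff 1]
  simp_rw [succ_mul_pow_div_factorial]
  exact (Real.summable_pow_div_factorial x).mul_left x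

/-- The tail of the Poisson weights is at least its first term. -/
theorem pow_div_factorial_le_tsum (r : ℕ) {x : ℝ} (hx : 0 < x) :
    x ^ r / (Nat.factorial r : ℝ) ≤ ∑' j : ℕ, x ^ (j + r) / (Nat.factorial (j + r) : ℝ) := by
  have hs := (summable_nat_add_iff r).2 (Real.summable_pow_div_factorial x)
  simpa using hs.le_tsum 0 fun j _ => by positivity

theorem tsum_pow_div_factorial_pos (r : ℕ) {x : ℝ} (hx : 0 < x) :
    0 < ∑' j : ℕ, x ^ (j + r) / (Nat.factorial (j + r) : ℝ) :=
  lt_of_lt_of_le (by positivity) (pow_div_factorial_le_tsum r hx)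

/-- The truncated mean exceeds `x` by `r` times the conditional probability of the value `r`. -/
theorem truncMean_eq (r : ℕ) {x : ℝ} (hx : 0 < x) :
    truncMean r x = x + r * ((x ^ r / (Nat.factorial r : ℝ)) /
      ∑' j : ℕ, x ^ (j + r) / (Nat.factorial (j + r) : ℝ)) := by
  have hpos := tsum_pow_div_factorial_pos r hx
  have hs := (summable_nat_add_iff r).2 (summable_mul_pow_div_factorial x)
  rw [truncMean, tsum_ite_le_eq_tsum_add r (summable_mul_pow_div_factorial x),
    tsum_ite_le_eq_tsum_add r (Real.summable_pow_div_factorial x), hs.tsum_eq_zero_add]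
  simp_rw [Nat.add_right_comm _ 1 r, succ_mul_pow_div_factorial, tsum_mul_left, zero_add]
  rw [div_eq_iff hpos.ne', add_mul, mul_assoc (r : ℝ), div_mul_cancel₀ _ hpos.ne']
  ring

theorem le_truncMean (r : ℕ) {x : ℝ} (hx : 0 < x) : x ≤ truncMean r x := by
  have hpos := tsum_pow_div_factorial_pos r hx
  rw [truncMean_eq r hx]
  exact le_add_of_nonneg_right (by positivity)

theorem truncMean_le_add (r : ℕ) {x : ℝ} (hx : 0 < x) : truncMean r x ≤ x + r := by
  rw [truncMean_eq r hx]
  gcongr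
  exact mul_le_of_le_one_right r.cast_nonneg
    (div_le_one_of_le₀ (pow_div_factorial_le_tsum r hx) (tsum_pow_div_factorial_pos r hx).le)

theorem natCast_le_truncMean (r : ℕ) {x : ℝ} (hx : 0 < x) : (r : ℝ) ≤ truncMean r x := by
  have hs := summable_mul_pow_div_factorial x
  have ht := Real.summable_pow_div_factorial x
  rw [truncMean, tsum_ite_le_eq_tsum_add r hs, tsum_ite_le_eq_tsum_add r ht,
    le_div_iff₀ (tsum_pow_div_factorial_pos r hx), ← tsum_mul_left]
  refine Summable.tsum_le_tsum (fun j => ?_) (((summable_nat_add_iff r).2 ht).mul_left _)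
    ((summable_nat_add_iff r).2 hs)
  rw [mul_div_assoc]
  gcongr
  exact Nat.le_add_left r j

/-- For every integer `r ≥ 1` and real `x > 0`,
`max{x, r} ≤ λ_r(x) ≤ x + r`, and consequently `λ_r(x) ≤ λ_{r−1}(x) + r`. -/
theorem stmt_12 (r : ℕ) (hr : 1 ≤ r) (x : ℝ) (hx : 0 < x) :
    max x (r : ℝ) ≤ truncMean r x ∧ truncMean r x ≤ x + r ∧
      truncMean r x ≤ truncMean (r - 1) x + r :=
  ⟨max_le (le_truncMean r hx) (natCast_le_truncMean r hx), truncMean_le_add r hx,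
    (truncMean_le_add r hx).trans (by gcongr; exact le_truncMean (r - 1) hx)⟩
end

section
/- For every integer r ≥ 1 and every real λ > 0, Pr(Po_{≥r−1}(λ) = r−1) ≤ Pr(Po_{≥r}(λ) = r); equivalently, r·f_r(λ) ≤ λ·f_{r−1}(λ), i.e. λ^{r−1}/((r−1)!·f_{r−1}(λ)) ≤ λ^{r}/(r!·f_{r}(λ)). -/
open Filter Real

/-- `fTail ℓ x = e^x − ∑_{i=0}^{ℓ−1} x^i/i!` (so `fTail 0 x = e^x`). -/
noncomputable def fTail (ℓ : ℕ) (x : ℝ) : ℝ :=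
  Real.exp x - ∑ i ∈ Finset.range ℓ, x ^ i / (Nat.factorial i : ℝ)

theorem hasSum_fTail (k : ℕ) (x : ℝ) :
    HasSum (fun i : ℕ => x ^ (i + k) / (Nat.factorial (i + k) : ℝ)) (fTail k x) := by
  have h : HasSum (fun i : ℕ => x ^ i / (Nat.factorial i : ℝ)) (Real.exp x) := by
    rw [Real.exp_eq_exp_ℝ]
    exact NormedSpace.expSeries_div_hasSum_exp x
  exact (hasSum_nat_add_iff' k).mpr h

theorem fTail_pos (k : ℕ) {x : ℝ} (hx : 0 < x) : 0 < fTail k x := by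
  have h := hasSum_fTail k x
  rw [← h.tsum_eq]
  exact h.summable.tsum_pos (fun i => by positivity) 0 (by positivity)

theorem succ_mul_fTail_succ_le (k : ℕ) {x : ℝ} (hx : 0 < x) :
    ((k : ℝ) + 1) * fTail (k + 1) x ≤ x * fTail k x := by
  refine hasSum_le (fun i => ?_) ((hasSum_fTail (k + 1) x).mul_left _)
    ((hasSum_fTail k x).mul_left x)
  rw [← add_assoc, Nat.factorial_succ, pow_succ, Nat.cast_mul, ← mul_div_assoc,
    ← mul_div_assoc, div_le_div_iff₀ (by positivity) (by positivity)]
  have hk : (k : ℝ) + 1 ≤ ((i + k + 1 : ℕ) : ℝ) := by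
    push_cast
    linarith [Nat.cast_nonneg (α := ℝ) i]
  calc _ = (k + 1 : ℝ) * (x ^ (i + k) * x * (Nat.factorial (i + k) : ℝ)) := by ring
    _ ≤ ((i + k + 1 : ℕ) : ℝ) * (x ^ (i + k) * x * (Nat.factorial (i + k) : ℝ)) := by gcongr
    _ = _ := by ring

/-- For every integer `r ≥ 1` and real `λ > 0`,
`Pr(Po_{≥r−1}(λ) = r−1) ≤ Pr(Po_{≥r}(λ) = r)`; equivalently
`r·f_r(λ) ≤ λ·f_{r−1}(λ)`, i.e.
`λ^{r−1}/((r−1)!·f_{r−1}(λ)) ≤ λ^r/(r!·f_r(λ))`. -/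
theorem stmt_14 (r : ℕ) (hr : 1 ≤ r) (l : ℝ) (hl : 0 < l) :
    (r : ℝ) * fTail r l ≤ l * fTail (r - 1) l ∧
    l ^ (r - 1) / ((Nat.factorial (r - 1) : ℝ) * fTail (r - 1) l) ≤
      l ^ r / ((Nat.factorial r : ℝ) * fTail r l) := by
  obtain ⟨k, rfl⟩ := Nat.exists_eq_add_of_le' hr
  have h := succ_mul_fTail_succ_le k hl
  have h₀ := fTail_pos k hl
  have h₁ := fTail_pos (k + 1) hl
  simp only [Nat.add_sub_cancel]
  refine ⟨by exact_mod_cast h, ?_⟩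
  rw [div_le_div_iff₀ (by positivity) (by positivity), Nat.factorial_succ]
  push_cast
  calc _ = l ^ k * (Nat.factorial k : ℝ) * (((k : ℝ) + 1) * fTail (k + 1) l) := by ring
    _ ≤ l ^ k * (Nat.factorial k : ℝ) * (l * fTail k l) := by gcongr
    _ = _ := by ring
end
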